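/- Suppose j ≥ 3 and α = α_1⋯α_j and β = β_1⋯β_j are minimal overlapping permutations in S_j with α_1 = β_1 = 1, α_j = β_j, des(α) = des(β), and inv(α) = inv(β). Then for all n ≥ 0, Σ_{σ∈NM_n(α)} x^{des(σ)} q^{inv(σ)} = Σ_{σ∈NM_n(β)} x^{des(σ)} q^{inv(σ)}, as polynomials in x and q; that is, α and β are (des,inv)-c-Wilf equivalent. -/

import Mathlib

open scoped Classical

noncomputable section

namespace CWilf

/-- The number of descents of a permutation of `{0, …, n-1}` (0-based). -/
def des {n : ℕ} (σ : Equiv.Perm (Fin n)) : ℕ :=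
  (Finset.univ.filter fun i : Fin n =>
    ∃ h : (i : ℕ) + 1 < n, σ ⟨(i : ℕ) + 1, h⟩ < σ i).card

/-- The number of inversions of `σ`. -/
def inv {n : ℕ} (σ : Equiv.Perm (Fin n)) : ℕ :=
  (Finset.univ.filter fun q : Fin n × Fin n => q.1 < q.2 ∧ σ q.2 < σ q.1).card

/-- The number of coinversions of `σ`. -/
def coinv {n : ℕ} (σ : Equiv.Perm (Fin n)) : ℕ :=
  (Finset.univ.filter fun q : Fin n × Fin n => q.1 < q.2 ∧ σ q.1 < σ q.2).card

/-- The number of left-to-right minima of `σ`. -/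
def LRmin {n : ℕ} (σ : Equiv.Perm (Fin n)) : ℕ :=
  (Finset.univ.filter fun j : Fin n => ∀ i : Fin n, i < j → σ j < σ i).card

/-- There is a `τ`-match of `σ` starting at (0-based) position `i`, i.e.
`red(σ_i σ_{i+1} ⋯ σ_{i+j-1}) = τ`. -/
def MatchAt {j n : ℕ} (τ : Equiv.Perm (Fin j)) (σ : Equiv.Perm (Fin n)) (i : ℕ) : Prop :=
  ∃ h : i + j ≤ n, ∀ a b : Fin j,
    τ a < τ b ↔
      σ ⟨i + (a : ℕ), by have := a.isLt; omega⟩ < σ ⟨i + (b : ℕ), by have := b.isLt; omega⟩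

/-- The number of `τ`-matches of `σ`. -/
def mch {j n : ℕ} (τ : Equiv.Perm (Fin j)) (σ : Equiv.Perm (Fin n)) : ℕ :=
  ((Finset.range n).filter fun i => MatchAt τ σ i).card

/-- `τ` is minimal overlapping: the smallest `n` such that some `σ ∈ S_n` has
exactly two `τ`-matches is `2j - 1`. -/
def MinOverlapping {j : ℕ} (τ : Equiv.Perm (Fin j)) : Prop :=
  IsLeast {n : ℕ | ∃ σ : Equiv.Perm (Fin n), mch τ σ = 2} (2 * j - 1)

/-- `α` and `β` are mutually minimal overlapping. -/
def MutuallyMinOverlapping {j : ℕ} (α β : Equiv.Perm (Fin j)) : Prop :=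
  MinOverlapping α ∧ MinOverlapping β ∧
    IsLeast {n : ℕ | ∃ σ : Equiv.Perm (Fin n), 1 ≤ mch α σ ∧ 1 ≤ mch β σ} (2 * j - 1)

/-- The set of permutations of `S_n` with no `τ`-match. -/
def NM (n : ℕ) {j : ℕ} (τ : Equiv.Perm (Fin j)) : Finset (Equiv.Perm (Fin n)) :=
  Finset.univ.filter fun σ => mch τ σ = 0


/-- The embedding of `{0, …, j-1}` into `{0, …, n-1}` as the block of positions starting at `i`. -/
def blockEmb {j n : ℕ} (i : ℕ) (h : i + j ≤ n) : Fin j ↪ Fin n where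
  toFun a := ⟨i + a, by omega⟩
  inj' a b hab := by
    simp only [Fin.mk.injEq] at hab
    omega

lemma blockEmb_val {j n i : ℕ} (h : i + j ≤ n) (a : Fin j) : (blockEmb i h a : ℕ) = i + a := rfl

lemma exists_blockEmb {j n i : ℕ} (h : i + j ≤ n) (p : Fin n) (h₁ : i ≤ p) (h₂ : (p : ℕ) < i + j) :
    ∃ a, blockEmb i h a = p :=
  ⟨⟨p - i, by omega⟩, Fin.ext (by rw [blockEmb_val]; simp only; omega)⟩

lemma matchAt_iff {j n i : ℕ} (h : i + j ≤ n) (τ : Equiv.Perm (Fin j)) (σ : Equiv.Perm (Fin n)) :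
    MatchAt τ σ i ↔ ∀ a b, τ a < τ b ↔ σ (blockEmb i h a) < σ (blockEmb i h b) :=
  ⟨fun ⟨_, H⟩ => H, fun H => ⟨h, H⟩⟩

/-- The standardization of a window of a permutation. -/
lemma exists_window {n m i : ℕ} (h : i + m ≤ n) (σ : Equiv.Perm (Fin n)) :
    ∃ ρ : Equiv.Perm (Fin m), ∀ a b, ρ a < ρ b ↔ σ (blockEmb i h a) < σ (blockEmb i h b) := by
  set f : Fin m → Fin n := fun a => σ (blockEmb i h a) with hf
  have hinj : Function.Injective f := σ.injective.comp (blockEmb i h).injective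
  have hmono : StrictMono (f ∘ Tuple.sort f) :=
    (Tuple.monotone_sort f).strictMono_of_injective (hinj.comp (Tuple.sort f).injective)
  refine ⟨(Tuple.sort f)⁻¹, fun a b => ?_⟩
  rw [← hmono.lt_iff_lt]
  simp [hf]

lemma matchAt_window {j n m i : ℕ} (h : i + m ≤ n) {σ : Equiv.Perm (Fin n)}
    {ρ : Equiv.Perm (Fin m)}
    (hρ : ∀ a b, ρ a < ρ b ↔ σ (blockEmb i h a) < σ (blockEmb i h b))
    (τ : Equiv.Perm (Fin j)) {p : ℕ} (hp : p + j ≤ m) :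
    MatchAt τ ρ p ↔ MatchAt τ σ (i + p) := by
  rw [matchAt_iff hp, matchAt_iff (show i + p + j ≤ n by omega)]
  have key (a : Fin j) : blockEmb i h (blockEmb p hp a) =
      blockEmb (i + p) (show i + p + j ≤ n by omega) a :=
    Fin.ext (by simp only [blockEmb_val]; omega)
  simp only [hρ, key]

/-- Two distinct matches of a minimal overlapping permutation share at most one position. -/
lemma MinOverlapping.le_of_matchAt {j n i k : ℕ} (hj : 3 ≤ j) {τ : Equiv.Perm (Fin j)}
    (hτ : MinOverlapping τ) {σ : Equiv.Perm (Fin n)} (hik : i < k)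
    (hi : MatchAt τ σ i) (hk : MatchAt τ σ k) : i + j ≤ k + 1 := by
  by_contra hlt
  have hex : ∃ k, i < k ∧ MatchAt τ σ k := ⟨k, hik, hk⟩
  obtain ⟨l, ⟨hil, hl⟩, hmin⟩ : ∃ l, (i < l ∧ MatchAt τ σ l) ∧
      ∀ l', i < l' → MatchAt τ σ l' → l ≤ l' :=
    ⟨Nat.find hex, Nat.find_spec hex, fun l' h₁ h₂ => Nat.find_min' hex ⟨h₁, h₂⟩⟩
  have hlk := hmin k hik hk
  obtain ⟨hln, -⟩ := id hl
  obtain ⟨d, rfl⟩ := Nat.exists_eq_add_of_lt hil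
  have hw : i + (d + 1 + j) ≤ n := by omega
  obtain ⟨ρ, hρ⟩ := exists_window hw σ
  have hmem : d + 1 + j ∈ {n : ℕ | ∃ σ : Equiv.Perm (Fin n), mch τ σ = 2} := by
    refine ⟨ρ, ?_⟩
    have hset : ((Finset.range (d + 1 + j)).filter fun p => MatchAt τ ρ p) = {0, d + 1} := by
      ext p
      simp only [Finset.mem_filter, Finset.mem_range, Finset.mem_insert, Finset.mem_singleton]
      constructor
      · rintro ⟨-, hp⟩
        obtain ⟨hpj, -⟩ := id hp
        rw [matchAt_window hw hρ τ hpj] at hp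
        by_cases hp0 : p = 0
        · exact Or.inl hp0
        · have := hmin (i + p) (by omega) hp
          omega
      · rintro (rfl | rfl)
        · exact ⟨by omega, (matchAt_window hw hρ τ (by omega)).2 hi⟩
        · exact ⟨by omega, (matchAt_window hw hρ τ (by omega)).2 hl⟩
    rw [mch, hset, Finset.card_pair (by omega)]
  have := hτ.2 hmem
  omega

/-- The number of descents of `σ` at positions that do not lie inside the block `[i, i + j)`. -/
def desOutside {n : ℕ} (i j : ℕ) (σ : Equiv.Perm (Fin n)) : ℕ :=
  (Finset.univ.filter fun k : Fin n =>
    (∃ h : (k : ℕ) + 1 < n, σ ⟨(k : ℕ) + 1, h⟩ < σ k) ∧ ¬ (i ≤ k ∧ (k : ℕ) + 1 < i + j)).card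

/-- The number of inversions of `σ` not contained in the block `[i, i + j)`. -/
def invOutside {n : ℕ} (i j : ℕ) (σ : Equiv.Perm (Fin n)) : ℕ :=
  (Finset.univ.filter fun q : Fin n × Fin n =>
    (q.1 < q.2 ∧ σ q.2 < σ q.1) ∧ ¬ (i ≤ q.1 ∧ (q.2 : ℕ) < i + j)).card

lemma card_filter_eq_add {ι : Type*} [Fintype ι] (P Q : ι → Prop) [DecidablePred P]
    [DecidablePred Q] :
    (Finset.univ.filter P).card = (Finset.univ.filter fun x => P x ∧ Q x).card +
      (Finset.univ.filter fun x => P x ∧ ¬ Q x).card := by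
  rw [← Finset.filter_filter, ← Finset.filter_filter, Finset.card_filter_add_card_filter_not]

lemma des_eq_of_matchAt {j n i : ℕ} {τ : Equiv.Perm (Fin j)} {σ : Equiv.Perm (Fin n)}
    (hm : MatchAt τ σ i) : des σ = des τ + desOutside i j σ := by
  obtain ⟨h, -⟩ := id hm
  rw [matchAt_iff h] at hm
  have hτ : des τ = (Finset.univ.filter fun k : Fin n =>
      (∃ h : (k : ℕ) + 1 < n, σ ⟨(k : ℕ) + 1, h⟩ < σ k) ∧
        (i ≤ k ∧ (k : ℕ) + 1 < i + j)).card := by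
    rw [des, ← Finset.card_map (blockEmb i h)]
    congr 1
    ext k
    simp only [Finset.mem_map, Finset.mem_filter, Finset.mem_univ, true_and]
    constructor
    · rintro ⟨a, ⟨ha, hlt⟩, rfl⟩
      rw [hm] at hlt
      refine ⟨⟨by rw [blockEmb_val]; omega, hlt⟩, ?_⟩
      rw [blockEmb_val]
      omega
    · rintro ⟨⟨hk, hlt⟩, h₁, h₂⟩
      obtain ⟨a, rfl⟩ := exists_blockEmb h k h₁ (by omega)
      rw [blockEmb_val] at h₂
      refine ⟨a, ⟨by omega, ?_⟩, rfl⟩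
      rw [hm]
      exact hlt
  rw [hτ]
  exact card_filter_eq_add _ _

lemma inv_eq_of_matchAt {j n i : ℕ} {τ : Equiv.Perm (Fin j)} {σ : Equiv.Perm (Fin n)}
    (hm : MatchAt τ σ i) : inv σ = inv τ + invOutside i j σ := by
  obtain ⟨h, -⟩ := id hm
  rw [matchAt_iff h] at hm
  have hτ : inv τ = (Finset.univ.filter fun q : Fin n × Fin n =>
      (q.1 < q.2 ∧ σ q.2 < σ q.1) ∧ (i ≤ q.1 ∧ (q.2 : ℕ) < i + j)).card := by
    rw [inv, ← Finset.card_map ((blockEmb i h).prodMap (blockEmb i h))]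
    congr 1
    ext ⟨p, q⟩
    simp only [Finset.mem_map, Finset.mem_filter, Finset.mem_univ, true_and,
      Function.Embedding.coe_prodMap, Prod.exists, Prod.map_apply, Prod.mk.injEq]
    constructor
    · rintro ⟨a, b, ⟨hab, hlt⟩, rfl, rfl⟩
      rw [hm] at hlt
      simp only [Fin.lt_def, blockEmb_val] at hab ⊢
      exact ⟨⟨by omega, hlt⟩, by omega, by omega⟩
    · rintro ⟨⟨hpq, hlt⟩, h₁, h₂⟩
      obtain ⟨a, rfl⟩ := exists_blockEmb h p h₁ (by omega)
      obtain ⟨b, rfl⟩ := exists_blockEmb h q (by omega) h₂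
      rw [← hm] at hlt
      simp only [Fin.lt_def, blockEmb_val] at hpq
      exact ⟨a, b, ⟨by omega, hlt⟩, rfl, rfl⟩
  rw [hτ]
  exact card_filter_eq_add _ _

/-- The permutation of positions acting as `γ` on the block starting at `i` and trivially elsewhere. -/
def blockPerm {j n : ℕ} (i : ℕ) (h : i + j ≤ n) (γ : Equiv.Perm (Fin j)) : Equiv.Perm (Fin n) :=
  γ.viaFintypeEmbedding (blockEmb i h)

lemma blockPerm_blockEmb {j n i : ℕ} (h : i + j ≤ n) (γ : Equiv.Perm (Fin j)) (a : Fin j) :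
    blockPerm i h γ (blockEmb i h a) = blockEmb i h (γ a) :=
  Equiv.Perm.viaFintypeEmbedding_apply_image ..

lemma blockPerm_of_outside {j n i : ℕ} (h : i + j ≤ n) (γ : Equiv.Perm (Fin j)) {p : Fin n}
    (hp : ¬ (i ≤ p ∧ (p : ℕ) < i + j)) : blockPerm i h γ p = p := by
  apply Equiv.Perm.viaFintypeEmbedding_apply_notMem_range
  rintro ⟨a, rfl⟩
  rw [blockEmb_val] at hp
  omega

lemma blockPerm_mem {j n i : ℕ} (h : i + j ≤ n) (γ : Equiv.Perm (Fin j)) {p : Fin n}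
    (hp : i ≤ p ∧ (p : ℕ) < i + j) :
    i ≤ blockPerm i h γ p ∧ (blockPerm i h γ p : ℕ) < i + j := by
  obtain ⟨a, rfl⟩ := exists_blockEmb h p hp.1 hp.2
  rw [blockPerm_blockEmb, blockEmb_val]
  omega

/-- If `γ` fixes both ends, `blockPerm` only moves positions strictly inside the block. -/
lemma blockPerm_of_not_interior {j n i : ℕ} (h : i + j ≤ n) {γ : Equiv.Perm (Fin j)}
    (hγ : ∀ a : Fin j, (a : ℕ) = 0 ∨ (a : ℕ) + 1 = j → γ a = a) {p : Fin n}
    (hp : ¬ (i < p ∧ (p : ℕ) + 1 < i + j)) : blockPerm i h γ p = p := by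
  by_cases hb : i ≤ p ∧ (p : ℕ) < i + j
  · obtain ⟨a, rfl⟩ := exists_blockEmb h p hb.1 hb.2
    rw [blockEmb_val] at hp
    rw [blockPerm_blockEmb, hγ a (by omega)]
  · exact blockPerm_of_outside h γ hb

lemma desOutside_mul_blockPerm {j n i : ℕ} (h : i + j ≤ n) {γ : Equiv.Perm (Fin j)}
    (hγ : ∀ a : Fin j, (a : ℕ) = 0 ∨ (a : ℕ) + 1 = j → γ a = a) (σ : Equiv.Perm (Fin n)) :
    desOutside i j (σ * blockPerm i h γ) = desOutside i j σ := by
  unfold desOutside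
  congr 1
  refine Finset.filter_congr fun k _ => and_congr_left fun hk => exists_congr fun hkn => ?_
  rw [Equiv.Perm.mul_apply, Equiv.Perm.mul_apply,
    blockPerm_of_not_interior h hγ (show ¬ (i < k ∧ (k : ℕ) + 1 < i + j) by omega),
    blockPerm_of_not_interior h hγ (p := ⟨k + 1, hkn⟩) (by simp only; omega)]

lemma invOutside_mul_blockPerm {j n i : ℕ} (h : i + j ≤ n) (γ : Equiv.Perm (Fin j))
    (σ : Equiv.Perm (Fin n)) :
    invOutside i j (σ * blockPerm i h γ) = invOutside i j σ := by
  set π := blockPerm i h γ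
  have hin (p : Fin n) : (i ≤ π p ∧ (π p : ℕ) < i + j) ∧ (i ≤ p ∧ (p : ℕ) < i + j) ∨
      π p = p ∧ ¬ (i ≤ p ∧ (p : ℕ) < i + j) := by
    by_cases hp : i ≤ p ∧ (p : ℕ) < i + j
    · exact Or.inl ⟨blockPerm_mem h γ hp, hp⟩
    · exact Or.inr ⟨blockPerm_of_outside h γ hp, hp⟩
  unfold invOutside
  refine Finset.card_equiv (Equiv.prodCongr π π) fun ⟨p, q⟩ => ?_
  rw [Finset.mem_filter, Finset.mem_filter]
  simp only [Finset.mem_univ, true_and, Equiv.Perm.mul_apply, Equiv.prodCongr_apply,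
    Prod.map_apply]
  have hiff : p < q ∧ ¬ (i ≤ p ∧ (q : ℕ) < i + j) ↔
      π p < π q ∧ ¬ (i ≤ π p ∧ (π q : ℕ) < i + j) := by
    rcases hin p with hp | ⟨hp, hp'⟩ <;> rcases hin q with hq | ⟨hq, hq'⟩
    · simp only [Fin.lt_def]; omega
    · rw [hq]; simp only [Fin.lt_def]; omega
    · rw [hp]; simp only [Fin.lt_def]; omega
    · rw [hp, hq]
  rw [and_right_comm, hiff, and_right_comm]

lemma matchAt_mul_blockPerm {j n i : ℕ} (h : i + j ≤ n) (α β : Equiv.Perm (Fin j))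
    (σ : Equiv.Perm (Fin n)) :
    MatchAt β (σ * blockPerm i h (α⁻¹ * β)) i ↔ MatchAt α σ i := by
  rw [matchAt_iff h, matchAt_iff h]
  simp only [Equiv.Perm.mul_apply σ, blockPerm_blockEmb]
  constructor
  · intro H a b
    simpa using H ((α⁻¹ * β)⁻¹ a) ((α⁻¹ * β)⁻¹ b)
  · intro H a b
    rw [← H]
    simp

lemma matchAt_mul_blockPerm_of_far {j n i k : ℕ} (h : i + j ≤ n) {γ : Equiv.Perm (Fin j)}
    (hγ : ∀ a : Fin j, (a : ℕ) = 0 ∨ (a : ℕ) + 1 = j → γ a = a)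
    (hik : i + j ≤ k + 1 ∨ k + j ≤ i + 1) (τ : Equiv.Perm (Fin j)) (σ : Equiv.Perm (Fin n)) :
    MatchAt τ (σ * blockPerm i h γ) k ↔ MatchAt τ σ k := by
  by_cases hk : k + j ≤ n
  · rw [matchAt_iff hk, matchAt_iff hk]
    have key (a : Fin j) : blockPerm i h γ (blockEmb k hk a) = blockEmb k hk a :=
      blockPerm_of_not_interior h hγ (by rw [blockEmb_val]; omega)
    simp only [Equiv.Perm.mul_apply, key]
  · exact ⟨fun ⟨h', _⟩ => absurd h' hk, fun ⟨h', _⟩ => absurd h' hk⟩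

/-- The monomial `x ^ des σ * q ^ inv σ`. -/
def weight {n : ℕ} (σ : Equiv.Perm (Fin n)) : MvPolynomial (Fin 2) ℚ :=
  MvPolynomial.X 0 ^ des σ * MvPolynomial.X 1 ^ inv σ

/-- The weight enumerator of the permutations with `α`-matches at every position of `A` and
`β`-matches at every position of `B`. -/
def markedSum {j : ℕ} (n : ℕ) (α β : Equiv.Perm (Fin j)) (A B : Finset ℕ) :
    MvPolynomial (Fin 2) ℚ :=
  ∑ σ : Equiv.Perm (Fin n) with (∀ i ∈ A, MatchAt α σ i) ∧ ∀ i ∈ B, MatchAt β σ i, weight σ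

/-- Rearranging one marked `α`-match into a `β`-match preserves the weight enumerator. -/
lemma markedSum_insert {j n i : ℕ} {α β : Equiv.Perm (Fin j)}
    (hγ : ∀ a : Fin j, (a : ℕ) = 0 ∨ (a : ℕ) + 1 = j → α a = β a)
    (hdes : des α = des β) (hinv : inv α = inv β) {A B : Finset ℕ}
    (hA : ∀ k ∈ A, i + j ≤ k + 1 ∨ k + j ≤ i + 1) (hB : ∀ k ∈ B, i + j ≤ k + 1 ∨ k + j ≤ i + 1) :
    markedSum n α β (insert i A) B = markedSum n α β A (insert i B) := by
  by_cases h : i + j ≤ n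
  · have hγ' (a : Fin j) (ha : (a : ℕ) = 0 ∨ (a : ℕ) + 1 = j) : (α⁻¹ * β) a = a := by
      rw [Equiv.Perm.mul_apply, ← hγ a ha, Equiv.Perm.inv_def, Equiv.symm_apply_apply]
    refine Finset.sum_equiv (Equiv.mulRight (blockPerm i h (α⁻¹ * β))) (fun σ => ?_)
      fun σ hσ => ?_
    · simp only [Finset.mem_filter, Finset.mem_univ, true_and, Equiv.coe_mulRight,
        Finset.forall_mem_insert, matchAt_mul_blockPerm]
      rw [forall₂_congr fun k hk => matchAt_mul_blockPerm_of_far h hγ' (hA k hk) α σ,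
        forall₂_congr fun k hk => matchAt_mul_blockPerm_of_far h hγ' (hB k hk) β σ]
      tauto
    · simp only [Finset.mem_filter, Finset.mem_univ, true_and, Finset.forall_mem_insert] at hσ
      have hm := hσ.1.1
      have hm' := (matchAt_mul_blockPerm h α β σ).2 hm
      rw [weight, weight, Equiv.coe_mulRight, des_eq_of_matchAt hm, inv_eq_of_matchAt hm,
        des_eq_of_matchAt hm', inv_eq_of_matchAt hm', desOutside_mul_blockPerm h hγ',
        invOutside_mul_blockPerm, hdes, hinv]
  · have hno (τ : Equiv.Perm (Fin j)) (σ : Equiv.Perm (Fin n)) : ¬ MatchAt τ σ i :=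
      fun ⟨h', _⟩ => h h'
    simp [markedSum, hno]

lemma markedSum_eq {j n : ℕ} {α β : Equiv.Perm (Fin j)}
    (hγ : ∀ a : Fin j, (a : ℕ) = 0 ∨ (a : ℕ) + 1 = j → α a = β a)
    (hdes : des α = des β) (hinv : inv α = inv β) (A B : Finset ℕ) (hAB : Disjoint A B)
    (hgap : ∀ i ∈ A ∪ B, ∀ k ∈ A ∪ B, i < k → i + j ≤ k + 1) :
    markedSum n α β A B = markedSum n α β ∅ (A ∪ B) := by
  induction A using Finset.induction_on generalizing B with
  | empty => rw [Finset.empty_union]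
  | insert i A hi ih =>
    rw [Finset.disjoint_insert_left] at hAB
    have hfar (k : ℕ) (hk : k ∈ A ∪ B) : i + j ≤ k + 1 ∨ k + j ≤ i + 1 := by
      have hki : k ≠ i := by
        rintro rfl
        rcases Finset.mem_union.1 hk with hk | hk
        exacts [hi hk, hAB.1 hk]
      have hk' : k ∈ insert i A ∪ B := by
        rw [Finset.insert_union]
        exact Finset.mem_insert_of_mem hk
      have hi' : i ∈ insert i A ∪ B := by simp
      rcases hki.lt_or_gt with hlt | hlt
      exacts [Or.inr (hgap k hk' i hi' hlt), Or.inl (hgap i hi' k hk' hlt)]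
    have hU : A ∪ insert i B = insert i A ∪ B := by
      rw [Finset.union_insert, Finset.insert_union]
    rw [markedSum_insert hγ hdes hinv (fun k hk => hfar k (Finset.mem_union_left _ hk))
      (fun k hk => hfar k (Finset.mem_union_right _ hk)),
      ih (insert i B) (Finset.disjoint_insert_right.2 ⟨hi, hAB.2⟩) (by rwa [hU]), hU]

/-- Inclusion-exclusion for the permutations without matches. -/
lemma sum_NM_eq {j : ℕ} (n : ℕ) (τ : Equiv.Perm (Fin j)) :
    ∑ σ ∈ NM n τ, weight σ = ∑ t ∈ (Finset.range n).powerset,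
      (-1 : ℤ) ^ t.card • ∑ σ : Equiv.Perm (Fin n) with ∀ i ∈ t, MatchAt τ σ i, weight σ := by
  have key := Finset.inclusion_exclusion_sum_inf_compl (Finset.range n)
    (fun i => Finset.univ.filter fun σ : Equiv.Perm (Fin n) => MatchAt τ σ i) weight
  convert key using 2
  · ext σ
    simp [NM, mch, Finset.mem_inf, Finset.filter_eq_empty_iff]
  · congr 2
    ext σ
    simp [Finset.mem_inf]

/-- Theorem: if `α, β ∈ S_j` (`j ≥ 3`) are minimal overlapping, both start with `1`,
end with the same element, `des α = des β` and `inv α = inv β`, then for all `n ≥ 0`,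
`Σ_{σ∈NM_n(α)} x^{des σ} q^{inv σ} = Σ_{σ∈NM_n(β)} x^{des σ} q^{inv σ}` as polynomials
in `x` (= `X 0`) and `q` (= `X 1`), i.e. `α` and `β` are (des,inv)-c-Wilf equivalent. -/
theorem stmt8 {j : ℕ} (hj : 3 ≤ j) (α β : Equiv.Perm (Fin j))
    (hα : MinOverlapping α) (hβ : MinOverlapping β)
    (hα1 : α ⟨0, by omega⟩ = ⟨0, by omega⟩) (hβ1 : β ⟨0, by omega⟩ = ⟨0, by omega⟩)
    (hlast : α ⟨j - 1, by omega⟩ = β ⟨j - 1, by omega⟩)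
    (hdes : des α = des β) (hinv : inv α = inv β) :
    ∀ n : ℕ,
      (∑ σ ∈ NM n α,
        (MvPolynomial.X 0 : MvPolynomial (Fin 2) ℚ) ^ des σ * MvPolynomial.X 1 ^ inv σ) =
      ∑ σ ∈ NM n β,
        (MvPolynomial.X 0 : MvPolynomial (Fin 2) ℚ) ^ des σ * MvPolynomial.X 1 ^ inv σ := by
  intro n
  have hγ (a : Fin j) (ha : (a : ℕ) = 0 ∨ (a : ℕ) + 1 = j) : α a = β a := by
    rcases ha with ha | ha
    · rw [show a = ⟨0, by omega⟩ from Fin.ext ha, hα1, hβ1]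
    · rw [show a = ⟨j - 1, by omega⟩ from Fin.ext (by simp only; omega), hlast]
  change ∑ σ ∈ NM n α, weight σ = ∑ σ ∈ NM n β, weight σ
  rw [sum_NM_eq, sum_NM_eq]
  refine Finset.sum_congr rfl fun t _ => ?_
  congr 1
  by_cases hgap : ∀ i ∈ t, ∀ k ∈ t, i < k → i + j ≤ k + 1
  · have key := markedSum_eq (n := n) hγ hdes hinv t ∅ (Finset.disjoint_empty_right t)
      (by simpa using hgap)
    simpa [markedSum] using key
  · push Not at hgap
    obtain ⟨i, hi, k, hk, hik, hlt⟩ := hgap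
    have hno {τ : Equiv.Perm (Fin j)} (hτ : MinOverlapping τ) (σ : Equiv.Perm (Fin n)) :
        ¬ ∀ i ∈ t, MatchAt τ σ i := fun H =>
      hlt.not_ge (hτ.le_of_matchAt hj hik (H i hi) (H k hk))
    simp [hno hα, hno hβ]

end CWilf
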